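/- (Theorem 3.2 of the paper, main equation.) Let Γ be smooth symmetric connection coefficients on ℝ⁴ and let F : ℝ² → ℝ⁴, with parameters (τ,λ), be a smooth family of geodesics: ∂²_λF^μ + Γ^μ_{αβ}(F)·∂_λF^α·∂_λF^β = 0 for all (τ,λ). Set p := ∂_λF and X := ∂_τF. Let ξ : ℝ² → ℝ⁴ be a smooth family of solutions of the geodesic deviation equation: (∇_λ∇_λξ)^μ = R^μ_{ναβ}(F)·p^ν·p^α·ξ^β for all (τ,λ). Define the geodesic deviation operator 𝒢[η]^μ := (∇_λ∇_λη)^μ − R^μ_{ναβ}(F)·p^ν·p^α·η^β. Then the τ-derivative of ξ satisfies the inhomogeneous geodesic deviation equation 𝒢[∇_τξ]^μ = M^μ_ν·ξ^ν + N^μ_ν·(∇_λξ)^ν for all (τ,λ), where M^μ_ν := −(∇_αR^μ_{νρσ})(F)·p^α·X^ρ·p^σ + (∇_αR^μ_{βρν})(F)·X^α·p^β·p^ρ + 2·R^μ_{βσν}(F)·(∇_λX)^β·p^σ and N^μ_ν := −2·R^μ_{νρσ}(F)·X^ρ·p^σ, with the covariant derivative of the curvature tensor given by ∇_αR^μ_{νρσ}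 := ∂_αR^μ_{νρσ} + Γ^μ_{ακ}·R^κ_{νρσ} − Γ^κ_{αν}·R^μ_{κρσ} − Γ^κ_{αρ}·R^μ_{νκσ} − Γ^κ_{ασ}·R^μ_{νρκ}. -/

import Mathlib

open scoped BigOperators

/-- Points of the spacetime manifold ℝ⁴, in coordinates. -/
abbrev Pt : Type := Fin 4 → ℝ

/-- Connection coefficients `Γ^μ_{αβ}` on ℝ⁴. -/
abbrev Conn : Type := Pt → Fin 4 → Fin 4 → Fin 4 → ℝ

/-- Coordinate partial derivative `∂_α f` of a scalar field on ℝ⁴. -/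
noncomputable def pd (f : Pt → ℝ) (α : Fin 4) (x : Pt) : ℝ :=
  fderiv ℝ f x (Pi.single α 1)

/-- Curvature tensor `R^μ_{ναβ} = ∂_αΓ^μ_{βν} − ∂_βΓ^μ_{αν} + Γ^μ_{ακ}Γ^κ_{βν} − Γ^μ_{βκ}Γ^κ_{αν}`. -/
noncomputable def curv (Γ : Conn) (x : Pt) (μ ν α β : Fin 4) : ℝ :=
  pd (fun y => Γ y μ β ν) α x - pd (fun y => Γ y μ α ν) β x
    + ∑ κ, Γ x μ α κ * Γ x κ β ν - ∑ κ, Γ x μ β κ * Γ x κ α ν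

/-- `∂_λ F`, the partial derivative of a two-parameter family `F(τ,λ)` in `λ`. -/
noncomputable def dlam (F : ℝ → ℝ → Pt) : ℝ → ℝ → Pt :=
  fun τ l μ => deriv (fun s => F τ s μ) l

/-- `∂_τ F`, the partial derivative of a two-parameter family `F(τ,λ)` in `τ`. -/
noncomputable def dtau (F : ℝ → ℝ → Pt) : ℝ → ℝ → Pt :=
  fun τ l μ => deriv (fun s => F s l μ) τ

/-- Covariant `λ`-derivative of a vector field `V(τ,λ)` along `F`:
`(∇_λV)^μ = ∂_λV^μ + Γ^μ_{αβ}(F) ∂_λF^α V^β`. -/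
noncomputable def covLam (Γ : Conn) (F V : ℝ → ℝ → Pt) : ℝ → ℝ → Pt :=
  fun τ l μ => deriv (fun s => V τ s μ) l
    + ∑ α, ∑ β, Γ (F τ l) μ α β * dlam F τ l α * V τ l β

/-- Covariant `τ`-derivative of a vector field `V(τ,λ)` along `F`:
`(∇_τV)^μ = ∂_τV^μ + Γ^μ_{αβ}(F) ∂_τF^α V^β`. -/
noncomputable def covTau (Γ : Conn) (F V : ℝ → ℝ → Pt) : ℝ → ℝ → Pt :=
  fun τ l μ => deriv (fun s => V s l μ) τ
    + ∑ α, ∑ β, Γ (F τ l) μ α β * dtau F τ l α * V τ l β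

/-- The connection coefficients are smooth. -/
def SmoothConn (Γ : Conn) : Prop := ∀ μ α β, ContDiff ℝ (⊤ : ℕ∞) fun x => Γ x μ α β

/-- The connection coefficients are symmetric in the lower indices. -/
def SymmConn (Γ : Conn) : Prop := ∀ x μ α β, Γ x μ α β = Γ x μ β α

/-- A two-parameter family is smooth (jointly, in each component). -/
def SmoothFam (F : ℝ → ℝ → Pt) : Prop := ∀ μ, ContDiff ℝ (⊤ : ℕ∞) fun q : ℝ × ℝ => F q.1 q.2 μ


/-- Covariant derivative of the curvature tensor:
`∇_αR^μ_{νρσ} = ∂_αR^μ_{νρσ} + Γ^μ_{ακ}R^κ_{νρσ} − Γ^κ_{αν}R^μ_{κρσ}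
  − Γ^κ_{αρ}R^μ_{νκσ} − Γ^κ_{ασ}R^μ_{νρκ}`. -/
noncomputable def covCurv (Γ : Conn) (x : Pt) (α μ ν ρ σ : Fin 4) : ℝ :=
  pd (fun y => curv Γ y μ ν ρ σ) α x
    + ∑ κ, Γ x μ α κ * curv Γ x κ ν ρ σ
    - ∑ κ, Γ x κ α ν * curv Γ x μ κ ρ σ
    - ∑ κ, Γ x κ α ρ * curv Γ x μ ν κ σ
    - ∑ κ, Γ x κ α σ * curv Γ x μ ν ρ κ

/-- The inhomogeneity coefficient
`M^μ_ν = −(∇_αR^μ_{νρσ})p^αX^ρp^σ + (∇_αR^μ_{βρν})X^αp^βp^ρ + 2R^μ_{βσν}(∇_λX)^βp^σ`,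
where `p = ∂_λF` and `X = ∂_τF`. -/
noncomputable def Mdrift (Γ : Conn) (F : ℝ → ℝ → Pt) (τ l : ℝ) (μ ν : Fin 4) : ℝ :=
  -(∑ α, ∑ ρ, ∑ σ, covCurv Γ (F τ l) α μ ν ρ σ * dlam F τ l α * dtau F τ l ρ * dlam F τ l σ)
    + (∑ α, ∑ β, ∑ ρ, covCurv Γ (F τ l) α μ β ρ ν * dtau F τ l α * dlam F τ l β * dlam F τ l ρ)
    + 2 * ∑ β, ∑ σ, curv Γ (F τ l) μ β σ ν * covLam Γ F (dtau F) τ l β * dlam F τ l σ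

/-- The inhomogeneity coefficient `N^μ_ν = −2R^μ_{νρσ}X^ρp^σ`,
where `p = ∂_λF` and `X = ∂_τF`. -/
noncomputable def Ndrift (Γ : Conn) (F : ℝ → ℝ → Pt) (τ l : ℝ) (μ ν : Fin 4) : ℝ :=
  -2 * ∑ ρ, ∑ σ, curv Γ (F τ l) μ ν ρ σ * dtau F τ l ρ * dlam F τ l σ

/-- The geodesic deviation operator along `F(τ,·)`:
`𝒢[η]^μ = (∇_λ∇_λη)^μ − R^μ_{ναβ}(F) p^ν p^α η^β` with `p = ∂_λF`. -/
noncomputable def gdOp (Γ : Conn) (F η : ℝ → ℝ → Pt) : ℝ → ℝ → Pt :=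
  fun τ l μ => covLam Γ F (covLam Γ F η) τ l μ
    - ∑ ν, ∑ α, ∑ β, curv Γ (F τ l) μ ν α β * dlam F τ l ν * dlam F τ l α * η τ l β
/-- The curvature operator `(R(B,C)A)^μ = R^μ_{ναβ} A^ν B^α C^β` at the point `x`. -/
noncomputable def curvApply (Γ : Conn) (x A B C : Pt) : Pt := fun μ =>
  ∑ ν, ∑ α, ∑ β, curv Γ x μ ν α β * A ν * B α * C β

/-- The contraction `∇_δR^μ_{ναβ} D^δ A^ν B^α C^β` at the point `x`. -/
noncomputable def covCurvApply (Γ : Conn) (x D A B C : Pt) : Pt := fun μ =>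
  ∑ δ, ∑ ν, ∑ α, ∑ β, covCurv Γ x δ μ ν α β * D δ * A ν * B α * C β

/-- Covariant derivative of a vector field `v` along a single curve `f`. -/
noncomputable def covAlong (Γ : Conn) (f v : ℝ → Pt) (t : ℝ) : Pt := fun μ =>
  deriv (fun s => v s μ) t + ∑ α, ∑ β, Γ (f t) μ α β * deriv (fun s => f s α) t * v t β

/-! ### Smoothness -/

lemma contDiff_pd {f : Pt → ℝ} (hf : ContDiff ℝ (⊤ : ℕ∞) f) (α : Fin 4) :
    ContDiff ℝ (⊤ : ℕ∞) (pd f α) :=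
  (hf.fderiv_right (m := (⊤ : ℕ∞)) (by simp)).clm_apply contDiff_const

lemma SmoothConn.curv {Γ : Conn} (hΓ : SmoothConn Γ) (μ ν α β : Fin 4) :
    ContDiff ℝ (⊤ : ℕ∞) fun x => curv Γ x μ ν α β := by
  unfold _root_.curv
  refine (((contDiff_pd (hΓ μ β ν) α).sub (contDiff_pd (hΓ μ α ν) β)).add
    (ContDiff.sum fun κ _ => (hΓ μ α κ).mul (hΓ κ β ν))).sub
    (ContDiff.sum fun κ _ => (hΓ μ β κ).mul (hΓ κ α ν))

lemma hasDerivAt_snd_slice {g : ℝ × ℝ → ℝ} {τ l : ℝ} (hg : DifferentiableAt ℝ g (τ, l)) :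
    HasDerivAt (fun s => g (τ, s)) (fderiv ℝ g (τ, l) (0, 1)) l :=
  hg.hasFDerivAt.comp_hasDerivAt l ((hasDerivAt_const l τ).prodMk (hasDerivAt_id l))

lemma hasDerivAt_fst_slice {g : ℝ × ℝ → ℝ} {τ l : ℝ} (hg : DifferentiableAt ℝ g (τ, l)) :
    HasDerivAt (fun s => g (s, l)) (fderiv ℝ g (τ, l) (1, 0)) τ :=
  hg.hasFDerivAt.comp_hasDerivAt τ ((hasDerivAt_id τ).prodMk (hasDerivAt_const τ l))

namespace SmoothFam

variable {F V : ℝ → ℝ → Pt}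

lemma differentiable (hF : SmoothFam F) (μ : Fin 4) :
    Differentiable ℝ fun q : ℝ × ℝ => F q.1 q.2 μ :=
  (hF μ).differentiable (by simp)

lemma dlam_eq (hF : SmoothFam F) (τ l : ℝ) (μ : Fin 4) :
    dlam F τ l μ = fderiv ℝ (fun q : ℝ × ℝ => F q.1 q.2 μ) (τ, l) (0, 1) :=
  (hasDerivAt_snd_slice (hF.differentiable μ (τ, l))).deriv

lemma dtau_eq (hF : SmoothFam F) (τ l : ℝ) (μ : Fin 4) :
    dtau F τ l μ = fderiv ℝ (fun q : ℝ × ℝ => F q.1 q.2 μ) (τ, l) (1, 0) :=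
  (hasDerivAt_fst_slice (hF.differentiable μ (τ, l))).deriv

lemma hasDerivAt_lam (hF : SmoothFam F) (τ l : ℝ) (μ : Fin 4) :
    HasDerivAt (fun s => F τ s μ) (dlam F τ l μ) l :=
  hF.dlam_eq τ l μ ▸ hasDerivAt_snd_slice (hF.differentiable μ (τ, l))

lemma hasDerivAt_tau (hF : SmoothFam F) (τ l : ℝ) (μ : Fin 4) :
    HasDerivAt (fun s => F s l μ) (dtau F τ l μ) τ :=
  hF.dtau_eq τ l μ ▸ hasDerivAt_fst_slice (hF.differentiable μ (τ, l))

lemma dlam (hF : SmoothFam F) : SmoothFam (dlam F) := fun μ => by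
  simp only [hF.dlam_eq]
  exact ((hF μ).fderiv_right (m := (⊤ : ℕ∞)) (by simp)).clm_apply contDiff_const

lemma dtau (hF : SmoothFam F) : SmoothFam (dtau F) := fun μ => by
  simp only [hF.dtau_eq]
  exact ((hF μ).fderiv_right (m := (⊤ : ℕ∞)) (by simp)).clm_apply contDiff_const

/-- Mixed partial derivatives of a smooth family commute. -/
lemma dlam_dtau (hF : SmoothFam F) : _root_.dlam (_root_.dtau F) = _root_.dtau (_root_.dlam F) := by
  funext τ l μ
  have hd : DifferentiableAt ℝ (fderiv ℝ fun q : ℝ × ℝ => F q.1 q.2 μ) (τ, l) :=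
    ((hF μ).fderiv_right (m := (⊤ : ℕ∞)) (by simp)).differentiable (by simp) _
  have hsymm : IsSymmSndFDerivAt ℝ (fun q : ℝ × ℝ => F q.1 q.2 μ) (τ, l) :=
    (hF μ).contDiffAt.isSymmSndFDerivAt (by simpa using WithTop.coe_le_coe.2 (le_top (a := (2 : ℕ∞))))
  rw [hF.dtau.dlam_eq, hF.dlam.dtau_eq]
  simp only [hF.dlam_eq, hF.dtau_eq, fderiv_clm_apply hd (differentiableAt_const _)]
  simpa using hsymm (0, 1) (1, 0)

lemma comp (hF : SmoothFam F) {g : Pt → ℝ} (hg : ContDiff ℝ (⊤ : ℕ∞) g) :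
    ContDiff ℝ (⊤ : ℕ∞) fun q : ℝ × ℝ => g (F q.1 q.2) :=
  hg.comp (contDiff_pi.2 hF)

lemma covLam {Γ : Conn} (hΓ : SmoothConn Γ) (hF : SmoothFam F) (hV : SmoothFam V) :
    SmoothFam (covLam Γ F V) := fun μ =>
  (hV.dlam μ).add <| ContDiff.sum fun α _ => ContDiff.sum fun β _ =>
    ((hF.comp (hΓ μ α β)).mul (hF.dlam α)).mul (hV β)

lemma covTau {Γ : Conn} (hΓ : SmoothConn Γ) (hF : SmoothFam F) (hV : SmoothFam V) :
    SmoothFam (covTau Γ F V) := fun μ =>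
  (hV.dtau μ).add <| ContDiff.sum fun α _ => ContDiff.sum fun β _ =>
    ((hF.comp (hΓ μ α β)).mul (hF.dtau α)).mul (hV β)

lemma curvApply {Γ : Conn} (hΓ : SmoothConn Γ) {A B C : ℝ → ℝ → Pt} (hF : SmoothFam F)
    (hA : SmoothFam A) (hB : SmoothFam B) (hC : SmoothFam C) :
    SmoothFam fun τ l => curvApply Γ (F τ l) (A τ l) (B τ l) (C τ l) := fun μ =>
  ContDiff.sum fun ν _ => ContDiff.sum fun α _ => ContDiff.sum fun β _ =>
    (((hF.comp (hΓ.curv μ ν α β)).mul (hA ν)).mul (hB α)).mul (hC β)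

end SmoothFam

/-! ### Differentiation along a curve -/

lemma hasDerivAt_comp_curve {g : Pt → ℝ} {f : ℝ → Pt} {f' : Pt} {t : ℝ}
    (hg : DifferentiableAt ℝ g (f t)) (hf : ∀ α, HasDerivAt (fun s => f s α) (f' α) t) :
    HasDerivAt (fun s => g (f s)) (∑ α, pd g α (f t) * f' α) t := by
  have hlin : fderiv ℝ g (f t) f' = ∑ α, pd g α (f t) * f' α := by
    conv_lhs => rw [← Finset.univ_sum_single f', map_sum]
    refine Finset.sum_congr rfl fun α _ => ?_
    rw [pd, mul_comm, ← smul_eq_mul, ← map_smul, ← Pi.single_smul, smul_eq_mul, mul_one]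
  exact hlin ▸ hg.hasFDerivAt.comp_hasDerivAt t (hasDerivAt_pi.2 hf)

lemma hasDerivAt_conn_contract {Γ : Conn} (hΓ : SmoothConn Γ) {f u v : ℝ → Pt} {f' u' v' : Pt}
    {t : ℝ} (hf : ∀ α, HasDerivAt (fun s => f s α) (f' α) t)
    (hu : ∀ α, HasDerivAt (fun s => u s α) (u' α) t)
    (hv : ∀ α, HasDerivAt (fun s => v s α) (v' α) t) (μ : Fin 4) :
    HasDerivAt (fun s => ∑ α, ∑ β, Γ (f s) μ α β * u s α * v s β)
      (∑ α, ∑ β, (((∑ κ, pd (fun y => Γ y μ α β) κ (f t) * f' κ) * u t α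
        + Γ (f t) μ α β * u' α) * v t β + Γ (f t) μ α β * u t α * v' β)) t :=
  HasDerivAt.fun_sum fun α _ => HasDerivAt.fun_sum fun β _ =>
    ((hasDerivAt_comp_curve ((hΓ μ α β).differentiable (by simp) _) hf).mul (hu α)).mul (hv β)

lemma covAlong_add {Γ : Conn} {f u v : ℝ → Pt} {u' v' : Pt} {t : ℝ}
    (hu : ∀ α, HasDerivAt (fun s => u s α) (u' α) t)
    (hv : ∀ α, HasDerivAt (fun s => v s α) (v' α) t) :
    covAlong Γ f (fun s => u s + v s) t = covAlong Γ f u t + covAlong Γ f v t := by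
  funext μ
  simp only [covAlong, Pi.add_apply, ((hu μ).fun_add (hv μ)).deriv, (hu μ).deriv, (hv μ).deriv,
    mul_add, Finset.sum_add_distrib]
  ring

/-! ### Pointwise tensor identities -/

section Contractions

variable {ι : Type*} [Fintype ι]

lemma sum_connection_first (G : ι → ι → ι → ℝ) (T : ι → ι → ι → ι → ℝ) (D A B C : ι → ℝ) (μ : ι) :
    ∑ δ, ∑ ν, ∑ α, ∑ β, (∑ κ, G μ δ κ * T κ ν α β) * D δ * A ν * B α * C β
      = ∑ δ, ∑ κ, G μ δ κ * D δ * ∑ ν, ∑ α, ∑ β, T κ ν α β * A ν * B α * C β := by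
  simp only [Finset.mul_sum, Finset.sum_mul, ← Fintype.sum_prod_type']
  exact Fintype.sum_equiv ⟨fun ⟨δ, ν, α, β, κ⟩ => ⟨δ, κ, ν, α, β⟩,
    fun ⟨δ, κ, ν, α, β⟩ => ⟨δ, ν, α, β, κ⟩, fun _ => rfl, fun _ => rfl⟩ _ _ fun _ => by
      dsimp; ring

lemma sum_connection_second (G : ι → ι → ι → ℝ) (T : ι → ι → ι → ℝ) (D A B C : ι → ℝ) :
    ∑ δ, ∑ ν, ∑ α, ∑ β, (∑ κ, G κ δ ν * T κ α β) * D δ * A ν * B α * C β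
      = ∑ κ, ∑ α, ∑ β, T κ α β * (∑ δ, ∑ ν, G κ δ ν * D δ * A ν) * B α * C β := by
  simp only [Finset.mul_sum, Finset.sum_mul, ← Fintype.sum_prod_type']
  exact Fintype.sum_equiv ⟨fun ⟨δ, ν, α, β, κ⟩ => ⟨κ, α, β, δ, ν⟩,
    fun ⟨κ, α, β, δ, ν⟩ => ⟨δ, ν, α, β, κ⟩, fun _ => rfl, fun _ => rfl⟩ _ _ fun _ => by
      dsimp; ring

lemma sum_connection_third (G : ι → ι → ι → ℝ) (T : ι → ι → ι → ℝ) (D A B C : ι → ℝ) :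
    ∑ δ, ∑ ν, ∑ α, ∑ β, (∑ κ, G κ δ α * T ν κ β) * D δ * A ν * B α * C β
      = ∑ ν, ∑ κ, ∑ β, T ν κ β * A ν * (∑ δ, ∑ α, G κ δ α * D δ * B α) * C β := by
  simp only [Finset.mul_sum, Finset.sum_mul, ← Fintype.sum_prod_type']
  exact Fintype.sum_equiv ⟨fun ⟨δ, ν, α, β, κ⟩ => ⟨ν, κ, β, δ, α⟩,
    fun ⟨ν, κ, β, δ, α⟩ => ⟨δ, ν, α, β, κ⟩, fun _ => rfl, fun _ => rfl⟩ _ _ fun _ => by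
      dsimp; ring

lemma sum_connection_fourth (G : ι → ι → ι → ℝ) (T : ι → ι → ι → ℝ) (D A B C : ι → ℝ) :
    ∑ δ, ∑ ν, ∑ α, ∑ β, (∑ κ, G κ δ β * T ν α κ) * D δ * A ν * B α * C β
      = ∑ ν, ∑ α, ∑ κ, T ν α κ * A ν * B α * ∑ δ, ∑ β, G κ δ β * D δ * C β := by
  simp only [Finset.mul_sum, Finset.sum_mul, ← Fintype.sum_prod_type']
  exact Fintype.sum_equiv ⟨fun ⟨δ, ν, α, β, κ⟩ => ⟨ν, α, κ, δ, β⟩,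
    fun ⟨ν, α, κ, δ, β⟩ => ⟨δ, ν, α, β, κ⟩, fun _ => rfl, fun _ => rfl⟩ _ _ fun _ => by
      dsimp; ring

lemma sum_derivative (T : ι → ι → ι → ι → ℝ) (D A B C : ι → ℝ) :
    ∑ δ, ∑ ν, ∑ α, ∑ β, T δ ν α β * D δ * A ν * B α * C β
      = ∑ ν, ∑ α, ∑ β, (∑ δ, T δ ν α β * D δ) * A ν * B α * C β := by
  simp only [Finset.sum_mul, ← Fintype.sum_prod_type']
  exact Fintype.sum_equiv ⟨fun ⟨δ, ν, α, β⟩ => ⟨ν, α, β, δ⟩,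
    fun ⟨ν, α, β, δ⟩ => ⟨δ, ν, α, β⟩, fun _ => rfl, fun _ => rfl⟩ _ _ fun _ => rfl

lemma sum_conn_deriv (T : ι → ι → ι → ℝ) (D A B : ι → ℝ) :
    ∑ α, ∑ β, (∑ δ, T δ α β * D δ) * A α * B β
      = ∑ β, ∑ δ, ∑ α, T δ α β * B β * D δ * A α := by
  simp only [Finset.sum_mul, ← Fintype.sum_prod_type']
  exact Fintype.sum_equiv ⟨fun ⟨α, β, δ⟩ => ⟨β, δ, α⟩,
    fun ⟨β, δ, α⟩ => ⟨α, β, δ⟩, fun _ => rfl, fun _ => rfl⟩ _ _ fun _ => by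
      dsimp; ring

lemma sum_conn_conn (G : ι → ι → ι → ℝ) (D A B : ι → ℝ) (μ : ι) :
    ∑ δ, ∑ κ, G μ δ κ * D δ * ∑ α, ∑ β, G κ α β * A α * B β
      = ∑ β, ∑ δ, ∑ α, (∑ κ, G μ δ κ * G κ α β) * B β * D δ * A α := by
  simp only [Finset.mul_sum, Finset.sum_mul, ← Fintype.sum_prod_type']
  exact Fintype.sum_equiv ⟨fun ⟨δ, κ, α, β⟩ => ⟨β, δ, α, κ⟩,
    fun ⟨β, δ, α, κ⟩ => ⟨δ, κ, α, β⟩, fun _ => rfl, fun _ => rfl⟩ _ _ fun _ => by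
      dsimp; ring

lemma sum_swap_slots (T : ι → ι → ι → ℝ) (A B C : ι → ℝ) :
    ∑ ν, ∑ α, ∑ β, T ν α β * A ν * B α * C β
      = ∑ ν, ∑ β, ∑ α, T ν α β * A ν * C β * B α := by
  refine Finset.sum_congr rfl fun ν _ => ?_
  rw [Finset.sum_comm]
  exact Finset.sum_congr rfl fun _ _ => Finset.sum_congr rfl fun _ _ => by ring

end Contractions

/-- Leibniz rule for the curvature operator along a curve. -/
lemma covAlong_curvApply {Γ : Conn} (hΓ : SmoothConn Γ) {f A B C : ℝ → Pt} {f' A' B' C' : Pt}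
    {t : ℝ} (hf : ∀ α, HasDerivAt (fun s => f s α) (f' α) t)
    (hA : ∀ α, HasDerivAt (fun s => A s α) (A' α) t)
    (hB : ∀ α, HasDerivAt (fun s => B s α) (B' α) t)
    (hC : ∀ α, HasDerivAt (fun s => C s α) (C' α) t) :
    covAlong Γ f (fun s => curvApply Γ (f s) (A s) (B s) (C s)) t
      = covCurvApply Γ (f t) f' (A t) (B t) (C t)
        + curvApply Γ (f t) (covAlong Γ f A t) (B t) (C t)
        + curvApply Γ (f t) (A t) (covAlong Γ f B t) (C t)
        + curvApply Γ (f t) (A t) (B t) (covAlong Γ f C t) := by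
  funext μ
  have hd : HasDerivAt (fun s => curvApply Γ (f s) (A s) (B s) (C s) μ) _ t :=
    HasDerivAt.fun_sum fun ν _ => HasDerivAt.fun_sum fun α _ => HasDerivAt.fun_sum fun β _ =>
      (((hasDerivAt_comp_curve ((hΓ.curv μ ν α β).differentiable (by simp) _) hf).mul
        (hA ν)).mul (hB α)).mul (hC β)
  rw [covAlong, hd.deriv]
  simp only [covAlong, Pi.mul_apply, (hf _).deriv, (hA _).deriv, (hB _).deriv, (hC _).deriv,
    Pi.add_apply, covCurvApply, curvApply, covCurv, add_mul, sub_mul, mul_add,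
    Finset.sum_add_distrib, Finset.sum_sub_distrib]
  rw [sum_connection_first (Γ (f t)) (curv Γ (f t)),
    sum_connection_second (Γ (f t)) (curv Γ (f t) μ),
    sum_connection_third (Γ (f t)) (curv Γ (f t) μ),
    sum_connection_fourth (Γ (f t)) (curv Γ (f t) μ),
    sum_derivative fun δ ν α β => pd (fun y => curv Γ y μ ν α β) δ (f t)]
  ring

lemma curv_antisymm (Γ : Conn) (x : Pt) (μ ν α β : Fin 4) :
    curv Γ x μ ν α β = -curv Γ x μ ν β α := by
  unfold curv
  ring

lemma covCurv_antisymm (Γ : Conn) (x : Pt) (δ μ ν α β : Fin 4) :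
    covCurv Γ x δ μ ν α β = -covCurv Γ x δ μ ν β α := by
  have hpd : pd (fun y => curv Γ y μ ν α β) δ x = -pd (fun y => curv Γ y μ ν β α) δ x := by
    simp only [pd, curv_antisymm Γ _ μ ν α β, fderiv_fun_neg, neg_apply]
  simp only [covCurv, hpd, curv_antisymm Γ x _ _ α β, curv_antisymm Γ x _ _ _ β,
    curv_antisymm Γ x _ _ α _, mul_neg, Finset.sum_neg_distrib]
  ring

/-- First Bianchi identity. -/
lemma curv_bianchi {Γ : Conn} (hΓ : SymmConn Γ) (x : Pt) (μ ν α β : Fin 4) :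
    curv Γ x μ ν α β + curv Γ x μ α β ν + curv Γ x μ β ν α = 0 := by
  have h : ∀ κ a b, (fun y => Γ y κ a b) = fun y => Γ y κ b a :=
    fun κ a b => funext fun y => hΓ y κ a b
  unfold curv
  rw [h μ β ν, h μ ν α, h μ α β]
  simp only [hΓ x _ β ν, hΓ x _ ν α, hΓ x _ α β]
  ring

lemma curvApply_bianchi {Γ : Conn} (hΓ : SymmConn Γ) (x A B C : Pt) :
    curvApply Γ x A B C + curvApply Γ x B C A + curvApply Γ x C A B = 0 := by
  funext μ
  have h₁ : curvApply Γ x B C A μ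
      = ∑ ν, ∑ α, ∑ β, curv Γ x μ α β ν * A ν * B α * C β := by
    simp only [curvApply, ← Fintype.sum_prod_type']
    exact Fintype.sum_equiv ⟨fun ⟨α, β, ν⟩ => ⟨ν, α, β⟩, fun ⟨ν, α, β⟩ => ⟨α, β, ν⟩,
      fun _ => rfl, fun _ => rfl⟩ _ _ fun _ => by dsimp; ring
  have h₂ : curvApply Γ x C A B μ
      = ∑ ν, ∑ α, ∑ β, curv Γ x μ β ν α * A ν * B α * C β := by
    simp only [curvApply, ← Fintype.sum_prod_type']
    exact Fintype.sum_equiv ⟨fun ⟨β, ν, α⟩ => ⟨ν, α, β⟩, fun ⟨ν, α, β⟩ => ⟨β, ν, α⟩,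
      fun _ => rfl, fun _ => rfl⟩ _ _ fun _ => by dsimp; ring
  simp only [Pi.add_apply, h₁, h₂, Pi.zero_apply]
  simp only [curvApply, ← Finset.sum_add_distrib, ← add_mul, curv_bianchi hΓ, zero_mul,
    Finset.sum_const_zero]

lemma curvApply_antisymm (Γ : Conn) (x A B C : Pt) :
    curvApply Γ x A B C = -curvApply Γ x A C B := by
  funext μ
  simp only [curvApply, Pi.neg_apply, ← Finset.sum_neg_distrib]
  refine Finset.sum_congr rfl fun ν _ => ?_
  rw [Finset.sum_comm]
  refine Finset.sum_congr rfl fun α _ => Finset.sum_congr rfl fun β _ => ?_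
  rw [curv_antisymm]
  ring

/-! ### Two-parameter families -/

/-- Covariant derivatives along a two-parameter family commute up to curvature. -/
lemma covLam_covTau {Γ : Conn} (hΓ : SmoothConn Γ) {F V : ℝ → ℝ → Pt} (hF : SmoothFam F)
    (hV : SmoothFam V) (τ l : ℝ) :
    covLam Γ F (covTau Γ F V) τ l = covTau Γ F (covLam Γ F V) τ l
      + curvApply Γ (F τ l) (V τ l) (dlam F τ l) (dtau F τ l) := by
  funext μ
  have hl := (hV.dtau.hasDerivAt_lam τ l μ).fun_add <| hasDerivAt_conn_contract hΓ
    (hF.hasDerivAt_lam τ l) (hF.dtau.hasDerivAt_lam τ l) (hV.hasDerivAt_lam τ l) μ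
  have ht := (hV.dlam.hasDerivAt_tau τ l μ).fun_add <| hasDerivAt_conn_contract hΓ
    (f := fun s => F s l) (u := fun s => dlam F s l) (v := fun s => V s l)
    (hF.hasDerivAt_tau τ l) (hF.dlam.hasDerivAt_tau τ l) (hV.hasDerivAt_tau τ l) μ
  have hl' : deriv (fun s => covTau Γ F V τ s μ) l = _ := hl.deriv
  have ht' : deriv (fun s => covLam Γ F V s l μ) τ = _ := ht.deriv
  rw [covLam, hl', Pi.add_apply, covTau, ht', hF.dlam_dtau, hV.dlam_dtau]
  have e₁ : ∀ β, covTau Γ F V τ l β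
      = dtau V τ l β + ∑ ρ, ∑ σ, Γ (F τ l) β ρ σ * dtau F τ l ρ * V τ l σ := fun _ => rfl
  have e₂ : ∀ β, covLam Γ F V τ l β
      = dlam V τ l β + ∑ ρ, ∑ σ, Γ (F τ l) β ρ σ * dlam F τ l ρ * V τ l σ := fun _ => rfl
  simp only [e₁, e₂, curvApply, curv, add_mul, sub_mul, mul_add, Finset.sum_add_distrib,
    Finset.sum_sub_distrib]
  rw [sum_conn_deriv fun κ α β => pd (fun y => Γ y μ α β) κ (F τ l),
    sum_conn_deriv fun κ α β => pd (fun y => Γ y μ α β) κ (F τ l),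
    sum_conn_conn (Γ (F τ l)), sum_conn_conn (Γ (F τ l)),
    sum_swap_slots fun ν α β => pd (fun y => Γ y μ α ν) β (F τ l),
    sum_swap_slots fun ν α β => ∑ κ, Γ (F τ l) μ β κ * Γ (F τ l) κ α ν]
  ring

/-- The torsion-free identity `∇_τ ∂_λF = ∇_λ ∂_τF`. -/
lemma covTau_dlam {Γ : Conn} (hΓ : SymmConn Γ) {F : ℝ → ℝ → Pt} (hF : SmoothFam F) (τ l : ℝ) :
    covTau Γ F (dlam F) τ l = covLam Γ F (dtau F) τ l := by
  funext μ
  have h := congrFun (congrFun (congrFun hF.dlam_dtau τ) l) μ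
  simp only [covTau, covLam]
  refine congrArg₂ (· + ·) h.symm ?_
  rw [Finset.sum_comm]
  refine Finset.sum_congr rfl fun α _ => Finset.sum_congr rfl fun β _ => ?_
  rw [hΓ]
  ring

lemma sum_Mdrift_mul (Γ : Conn) (F : ℝ → ℝ → Pt) (τ l : ℝ) (v : Pt) (μ : Fin 4) :
    ∑ ν, Mdrift Γ F τ l μ ν * v ν
      = covCurvApply Γ (F τ l) (dlam F τ l) v (dlam F τ l) (dtau F τ l) μ
        + covCurvApply Γ (F τ l) (dtau F τ l) (dlam F τ l) (dlam F τ l) v μ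
        + 2 * curvApply Γ (F τ l) (covLam Γ F (dtau F) τ l) (dlam F τ l) v μ := by
  have h₁ : ∑ ν, -(∑ α, ∑ ρ, ∑ σ, covCurv Γ (F τ l) α μ ν ρ σ * dlam F τ l α * dtau F τ l ρ
        * dlam F τ l σ) * v ν
      = covCurvApply Γ (F τ l) (dlam F τ l) v (dlam F τ l) (dtau F τ l) μ := by
    simp only [covCurvApply, Finset.sum_mul, ← Finset.sum_neg_distrib, ← Fintype.sum_prod_type']
    exact Fintype.sum_equiv ⟨fun ⟨ν, α, ρ, σ⟩ => ⟨α, ν, σ, ρ⟩, fun ⟨α, ν, σ, ρ⟩ => ⟨ν, α, ρ, σ⟩,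
      fun _ => rfl, fun _ => rfl⟩ _ _ fun ⟨ν, α, ρ, σ⟩ => by
        dsimp; rw [covCurv_antisymm]; ring
  have h₂ : ∑ ν, (∑ α, ∑ β, ∑ ρ, covCurv Γ (F τ l) α μ β ρ ν * dtau F τ l α * dlam F τ l β
        * dlam F τ l ρ) * v ν
      = covCurvApply Γ (F τ l) (dtau F τ l) (dlam F τ l) (dlam F τ l) v μ := by
    simp only [covCurvApply, Finset.sum_mul, ← Fintype.sum_prod_type']
    exact Fintype.sum_equiv ⟨fun ⟨ν, α, β, ρ⟩ => ⟨α, β, ρ, ν⟩, fun ⟨α, β, ρ, ν⟩ => ⟨ν, α, β, ρ⟩,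
      fun _ => rfl, fun _ => rfl⟩ _ _ fun ⟨ν, α, β, ρ⟩ => by dsimp
  have h₃ : ∑ ν, (2 * ∑ β, ∑ σ, curv Γ (F τ l) μ β σ ν * covLam Γ F (dtau F) τ l β
        * dlam F τ l σ) * v ν
      = 2 * curvApply Γ (F τ l) (covLam Γ F (dtau F) τ l) (dlam F τ l) v μ := by
    simp only [curvApply, Finset.mul_sum, Finset.sum_mul, ← Fintype.sum_prod_type']
    exact Fintype.sum_equiv ⟨fun ⟨ν, β, σ⟩ => ⟨β, σ, ν⟩, fun ⟨β, σ, ν⟩ => ⟨ν, β, σ⟩,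
      fun _ => rfl, fun _ => rfl⟩ _ _ fun _ => by dsimp; ring
  simp only [Mdrift, add_mul, Finset.sum_add_distrib, h₁, h₂, h₃]

lemma sum_Ndrift_mul (Γ : Conn) (F : ℝ → ℝ → Pt) (τ l : ℝ) (v : Pt) (μ : Fin 4) :
    ∑ ν, Ndrift Γ F τ l μ ν * v ν
      = 2 * curvApply Γ (F τ l) v (dlam F τ l) (dtau F τ l) μ := by
  rw [curvApply_antisymm]
  simp only [Ndrift, curvApply, Pi.neg_apply, Finset.mul_sum, Finset.sum_mul,
    ← Finset.sum_neg_distrib]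
  refine Finset.sum_congr rfl fun ν _ => Finset.sum_congr rfl fun ρ _ =>
    Finset.sum_congr rfl fun σ _ => ?_
  ring

/-- Theorem 3.2 of the paper, main equation: for a smooth family of
geodesics `F(τ,λ)` of a smooth symmetric connection and a smooth family `ξ(τ,λ)` of
solutions of the geodesic deviation equation, the `τ`-derivative of `ξ` satisfies the
inhomogeneous geodesic deviation equation
`𝒢[∇_τξ]^μ = M^μ_ν ξ^ν + N^μ_ν (∇_λξ)^ν`. -/
theorem deviation_vector_drift
    (Γ : Conn) (hΓs : SmoothConn Γ) (hΓsym : SymmConn Γ)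
    (F : ℝ → ℝ → Pt) (hF : SmoothFam F)
    (hgeo : ∀ τ l μ, deriv (fun s => dlam F τ s μ) l
        + ∑ α, ∑ β, Γ (F τ l) μ α β * dlam F τ l α * dlam F τ l β = 0)
    (ξ : ℝ → ℝ → Pt) (hξ : SmoothFam ξ)
    (hGDE : ∀ τ l μ, covLam Γ F (covLam Γ F ξ) τ l μ
        = ∑ ν, ∑ α, ∑ β,
            curv Γ (F τ l) μ ν α β * dlam F τ l ν * dlam F τ l α * ξ τ l β) :
    ∀ τ l μ,
      gdOp Γ F (covTau Γ F ξ) τ l μ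
        = ∑ ν, Mdrift Γ F τ l μ ν * ξ τ l ν
          + ∑ ν, Ndrift Γ F τ l μ ν * covLam Γ F ξ τ l ν := by
  intro τ l μ
  have hp := hF.dlam
  have hX := hF.dtau
  have hηl : SmoothFam (covLam Γ F ξ) := hF.covLam hΓs hξ
  have hGDE' : covLam Γ F (covLam Γ F ξ)
      = fun τ l => curvApply Γ (F τ l) (dlam F τ l) (dlam F τ l) (ξ τ l) :=
    funext fun τ => funext fun l => funext fun μ => hGDE τ l μ
  have hcomm : covLam Γ F (covTau Γ F ξ) = fun τ l => covTau Γ F (covLam Γ F ξ) τ l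
      + curvApply Γ (F τ l) (ξ τ l) (dlam F τ l) (dtau F τ l) :=
    funext fun τ => funext fun l => covLam_covTau hΓs hF hξ τ l
  have hpar : covAlong Γ (F τ) (dlam F τ) l = 0 := funext fun μ => hgeo τ l μ
  have hsplit : covLam Γ F (covLam Γ F (covTau Γ F ξ)) τ l
      = covLam Γ F (covTau Γ F (covLam Γ F ξ)) τ l
        + covAlong Γ (F τ)
          (fun s => curvApply Γ (F τ s) (ξ τ s) (dlam F τ s) (dtau F τ s)) l := by
    rw [hcomm]
    exact covAlong_add ((hF.covTau hΓs hηl).hasDerivAt_lam τ l)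
      ((hF.curvApply hΓs hξ hp hX).hasDerivAt_lam τ l)
  have hlam := covAlong_curvApply hΓs (hF.hasDerivAt_lam τ l) (hξ.hasDerivAt_lam τ l)
    (hp.hasDerivAt_lam τ l) (hX.hasDerivAt_lam τ l)
  have htau : covTau Γ F (covLam Γ F (covLam Γ F ξ)) τ l
      = covCurvApply Γ (F τ l) (dtau F τ l) (dlam F τ l) (dlam F τ l) (ξ τ l)
        + curvApply Γ (F τ l) (covTau Γ F (dlam F) τ l) (dlam F τ l) (ξ τ l)
        + curvApply Γ (F τ l) (dlam F τ l) (covTau Γ F (dlam F) τ l) (ξ τ l)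
        + curvApply Γ (F τ l) (dlam F τ l) (dlam F τ l) (covTau Γ F ξ τ l) := by
    rw [hGDE']
    exact covAlong_curvApply hΓs (f := fun s => F s l) (A := fun s => dlam F s l)
      (B := fun s => dlam F s l) (C := fun s => ξ s l) (hF.hasDerivAt_tau τ l)
      (hp.hasDerivAt_tau τ l) (hp.hasDerivAt_tau τ l) (hξ.hasDerivAt_tau τ l)
  have hzero : curvApply Γ (F τ l) (ξ τ l) 0 (dtau F τ l) = 0 := by
    funext μ
    simp [curvApply]
  have hgd : gdOp Γ F (covTau Γ F ξ) τ l μ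
      = covLam Γ F (covLam Γ F (covTau Γ F ξ)) τ l μ
        - curvApply Γ (F τ l) (dlam F τ l) (dlam F τ l) (covTau Γ F ξ τ l) μ := rfl
  have hbianchi := congrFun (curvApply_bianchi hΓsym (F τ l) (ξ τ l) (dlam F τ l)
    (covLam Γ F (dtau F) τ l)) μ
  rw [curvApply_antisymm Γ _ (covLam Γ F (dtau F) τ l)] at hbianchi
  rw [hgd, hsplit, covLam_covTau hΓs hF hηl, htau, hlam, hpar, hzero, covTau_dlam hΓsym hF,
    sum_Mdrift_mul, sum_Ndrift_mul]
  have hξ' : covAlong Γ (F τ) (ξ τ) l = covLam Γ F ξ τ l := rfl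
  have hX' : covAlong Γ (F τ) (dtau F τ) l = covLam Γ F (dtau F) τ l := rfl
  simp only [hξ', hX', Pi.add_apply, Pi.neg_apply, Pi.zero_apply] at hbianchi ⊢
  linarith
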